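/- arXiv:2101.12707 — 2 statements merged into one kernel-verified Lean document; each statement's English description precedes it below -/
import Mathlib

section
/- Let A be an n×n integer matrix whose characteristic polynomial is irreducible over ℚ, having s real eigenvalues and 2t non-real complex eigenvalues (so n = s + 2t). Then there exists a finite abelian group G such that the Dirichlet group of A satisfies Ξ(A) ≅ G × ℤ^{s+t−1}. -/
/-- The Dirichlet group `Ξ(A)` of an `n × n` integer matrix `A`: the group of all integer
matrices that are invertible over the integers (elements of `GL (Fin n) ℤ`) and commute
with `A`. -/
def dirichletGroup {n : ℕ} (A : Matrix (Fin n) (Fin n) ℤ) : Subgroup (GL (Fin n) ℤ) where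
  carrier := {B | Commute ((B : Matrix (Fin n) (Fin n) ℤ)) A}
  one_mem' := Commute.one_left A
  mul_mem' := by
    intro a b ha hb
    show Commute (((a * b : GL (Fin n) ℤ) : Matrix (Fin n) (Fin n) ℤ)) A
    rw [Units.val_mul]
    exact ha.mul_left hb
  inv_mem' := by
    intro a ha
    exact ha.units_inv_left

open Polynomial NumberField

theorem fg_structure {G : Type} [CommGroup G] [Module.Finite ℤ (Additive G)] (H : Subgroup G)
    (e : ℕ) (he : e ≠ 0) (hH : ∀ g : G, g ^ e ∈ H) :
    ∃ (T : Type) (_ : CommGroup T) (_ : Finite T),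
      Nonempty (H ≃* (T × Multiplicative (Fin (Module.finrank ℤ (Additive G)) → ℤ))) := by
  let N : Submodule ℤ (Additive G) := AddSubgroup.toIntSubmodule (Subgroup.toAddSubgroup H)
  have h1 : Module.finrank ℤ (Additive G ⧸ N) = 0 := by
    rw [Module.finrank_eq_zero_iff_isTorsion]
    intro x
    obtain ⟨g, rfl⟩ := N.mkQ_surjective x
    refine ⟨⟨(e : ℤ), mem_nonZeroDivisors_of_ne_zero (by exact_mod_cast he)⟩, ?_⟩
    have : (e : ℤ) • N.mkQ g = 0 := by
      rw [← map_smul, Submodule.mkQ_apply, Submodule.Quotient.mk_eq_zero]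
      have := hH g.toMul
      rw [natCast_zsmul]
      exact this
    exact this
  have h2 := Submodule.finrank_quotient_add_finrank N
  rw [h1, zero_add] at h2
  have hfgN : Module.Finite ℤ N := inferInstance
  have hfg : AddGroup.FG N := Module.Finite.iff_addGroup_fg.mp hfgN
  obtain ⟨r, ι, _, p, hp, k, ⟨f⟩⟩ := AddCommGroup.equiv_free_prod_directSum_zmod N
  have : ∀ i, NeZero (p i ^ k i) := fun i => ⟨pow_ne_zero _ (hp i).ne_zero⟩
  have hfin : Finite (DirectSum ι fun i => ZMod (p i ^ k i)) :=
    Finite.of_equiv _ (DirectSum.addEquivProd (fun i => ZMod (p i ^ k i))).symm.toEquiv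
  have h3 : Module.finrank ℤ (DirectSum ι fun i => ZMod (p i ^ k i)) = 0 := by
    rw [Module.finrank_eq_zero_iff_isTorsion]
    exact isAddTorsion_iff_isTorsion_int.mp isAddTorsion_of_finite
  have h4 : r = Module.finrank ℤ (Additive G) := by
    have := f.toIntLinearEquiv.finrank_eq
    rw [h2] at this
    have h6 := Submodule.finrank_quotient_add_finrank
      (LinearMap.fst ℤ (Fin r →₀ ℤ) (DirectSum ι fun i => ZMod (p i ^ k i))).ker
    rw [(LinearMap.quotKerEquivRange _).finrank_eq, ← LinearMap.range_inr,
      LinearMap.finrank_range_of_inj LinearMap.inr_injective, h3,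
      LinearMap.range_eq_top.mpr LinearMap.fst_surjective, finrank_top] at h6
    simp only [Module.finrank_finsupp_self, Fintype.card_fin] at h6
    omega
  rw [← h4]
  refine ⟨Multiplicative (DirectSum ι fun i => ZMod (p i ^ k i)), inferInstance, inferInstance, ⟨?_⟩⟩
  let f1 : N ≃+ (DirectSum ι fun i => ZMod (p i ^ k i)) × (Fin r → ℤ) :=
    f.trans ((AddEquiv.prodComm).trans
      ((AddEquiv.refl _).prodCongr (Finsupp.linearEquivFunOnFinite ℤ ℤ (Fin r)).toAddEquiv))
  exact { toFun := fun h => (Multiplicative.ofAdd (f1 ⟨Additive.ofMul h.1, h.2⟩).1, Multiplicative.ofAdd (f1 ⟨Additive.ofMul h.1, h.2⟩).2)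
          invFun := fun x => ⟨(f1.symm (x.1.toAdd, x.2.toAdd)).1.toMul, (f1.symm (x.1.toAdd, x.2.toAdd)).2⟩
          left_inv := fun h => by simp
          right_inv := fun x => by
            simp
          map_mul' := fun x y => by
            have := f1.map_add ⟨Additive.ofMul x.1, x.2⟩ ⟨Additive.ofMul y.1, y.2⟩
            exact this }

theorem nrReal_adjoinRoot (f : ℚ[X]) [Fact (Irreducible f)] [NumberField (AdjoinRoot f)] :
    InfinitePlace.nrRealPlaces (AdjoinRoot f) = (f.aroots ℝ).card := by
  classical
  have hf : Irreducible f := Fact.out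
  have hnd : (f.aroots ℝ).Nodup := nodup_roots hf.separable.map
  rw [← InfinitePlace.card_real_embeddings, ← Multiset.toFinset_card_of_nodup hnd,
    ← Fintype.card_coe]
  refine Fintype.card_congr ?_
  have e0 (ψ : AdjoinRoot f →+* ℝ) :
      ComplexEmbedding.IsReal (Complex.ofRealHom.comp ψ) := by
    rw [ComplexEmbedding.isReal_iff]
    refine RingHom.ext fun x => ?_
    simp [ComplexEmbedding.conjugate]
  have e1 : {φ : AdjoinRoot f →+* ℂ // ComplexEmbedding.IsReal φ} ≃ (AdjoinRoot f →+* ℝ) :=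
    { toFun := fun φ => φ.2.embedding
      invFun := fun ψ => ⟨Complex.ofRealHom.comp ψ, e0 ψ⟩
      left_inv := fun φ => Subtype.ext (RingHom.ext fun x => by simp)
      right_inv := fun ψ => RingHom.ext fun x => by
        have := ComplexEmbedding.IsReal.coe_embedding_apply (e0 ψ) x
        exact Complex.ofReal_injective this }
  refine e1.trans ((RingHom.equivRatAlgHom _ _).trans ((AdjoinRoot.equiv ℝ ℚ f hf.ne_zero).trans ?_))
  exact Equiv.subtypeEquivRight (by simp)

noncomputable def toMat {n : ℕ} (A : Matrix (Fin n) (Fin n) ℤ) :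
   AdjoinRoot (A.charpoly.map (Int.castRingHom ℚ)) →ₐ[ℚ] Matrix (Fin n) (Fin n) ℚ :=
  Ideal.Quotient.liftₐ _ (aeval ((Int.castRingHom ℚ).mapMatrix A)) (by
    intro a ha
    obtain ⟨b, rfl⟩ := Ideal.mem_span_singleton.mp ha
    rw [map_mul]
    have := Matrix.aeval_self_charpoly ((Int.castRingHom ℚ).mapMatrix A)
    rw [RingHom.mapMatrix_apply, Matrix.charpoly_map] at this
    rw [RingHom.mapMatrix_apply, this, zero_mul])

theorem toMat_mk {n : ℕ} (A : Matrix (Fin n) (Fin n) ℤ) (p : ℚ[X]) :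
   toMat A (AdjoinRoot.mk _ p) = aeval ((Int.castRingHom ℚ).mapMatrix A) p := rfl

theorem toMat_range {n : ℕ} (A : Matrix (Fin n) (Fin n) ℤ)
    (hA : Irreducible (A.charpoly.map (Int.castRingHom ℚ))) (B : Matrix (Fin n) (Fin n) ℚ)
    (hB : Commute B ((Int.castRingHom ℚ).mapMatrix A)) : ∃ x, toMat A x = B := by
  have : Fact (Irreducible (A.charpoly.map (Int.castRingHom ℚ))) := ⟨hA⟩
  have hdeg : (A.charpoly.map (Int.castRingHom ℚ)).natDegree = n := by
    rw [← Matrix.charpoly_map, Matrix.charpoly_natDegree_eq_dim, Fintype.card_fin]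
  have hn : 0 < n := hdeg ▸ hA.natDegree_pos
  have : Nonempty (Fin n) := ⟨⟨0, hn⟩⟩
  have hcomm (x) : B * toMat A x = toMat A x * B := by
    induction x using AdjoinRoot.induction_on with
    | ih p =>
      rw [toMat_mk]
      induction p using Polynomial.induction_on' with
      | add p q hp hq => rw [map_add, mul_add, add_mul, hp, hq]
      | monomial k a =>
        rw [aeval_monomial]
        exact Commute.mul_right (Algebra.commutes a B).symm (hB.pow_right k)
  let v : Fin n → ℚ := Pi.single ⟨0, hn⟩ 1
  have hv : v ≠ 0 := by simp [v]
  let L : AdjoinRoot (A.charpoly.map (Int.castRingHom ℚ)) →ₗ[ℚ] (Fin n → ℚ) :=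
    { toFun := fun x => (toMat A x).mulVec v
      map_add' := fun x y => by rw [map_add, Matrix.add_mulVec]
      map_smul' := fun c x => by rw [map_smul, Matrix.smul_mulVec, RingHom.id_apply] }
  have hLinj : Function.Injective L := by
    rw [injective_iff_map_eq_zero]
    intro x hx
    by_contra hne
    apply hv
    have h1 : (toMat A x⁻¹ * toMat A x).mulVec v = 0 := by
      rw [← Matrix.mulVec_mulVec]
      change (toMat A x⁻¹).mulVec (L x) = 0
      rw [hx, Matrix.mulVec_zero]
    rwa [← map_mul, inv_mul_cancel₀ hne, map_one, Matrix.one_mulVec] at h1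
  let pb := AdjoinRoot.powerBasis hA.ne_zero
  have hfd := pb.finite
  have hLsurj : Function.Surjective L := by
    refine (LinearMap.injective_iff_surjective_of_finrank_eq_finrank ?_).mp hLinj
    rw [pb.finrank, AdjoinRoot.powerBasis_dim, hdeg, Module.finrank_fin_fun]
  obtain ⟨x, hx⟩ := hLsurj (B.mulVec v)
  refine ⟨x, ?_⟩
  apply Matrix.mulVec_injective
  funext w
  obtain ⟨y, rfl⟩ := hLsurj w
  change (toMat A x).mulVec ((toMat A y).mulVec v) = B.mulVec ((toMat A y).mulVec v)
  rw [Matrix.mulVec_mulVec, Matrix.mulVec_mulVec, hcomm, ← map_mul, mul_comm, map_mul,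
    ← Matrix.mulVec_mulVec, ← Matrix.mulVec_mulVec]
  exact congrArg _ hx

theorem toMat_comm {n : ℕ} (A : Matrix (Fin n) (Fin n) ℤ) (x) :
   Commute (toMat A x) ((Int.castRingHom ℚ).mapMatrix A) := by
  have : (Int.castRingHom ℚ).mapMatrix A = toMat A (AdjoinRoot.root _) := by
    rw [AdjoinRoot.root, toMat_mk, aeval_X]
  rw [this, Commute, SemiconjBy, ← map_mul, mul_comm, map_mul]

theorem exists_denom {n : ℕ} {M : Type} [AddCommGroup M] [Module.Finite ℤ M]
    (g : M →+ Matrix (Fin n) (Fin n) ℚ) :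
    ∃ m : ℕ, m ≠ 0 ∧ ∀ x, ∃ B : Matrix (Fin n) (Fin n) ℤ, g (m • x) = (Int.castRingHom ℚ).mapMatrix B := by
  classical
  obtain ⟨S, hS⟩ := (Module.Finite.fg_top : (⊤ : Submodule ℤ M).FG)
  obtain ⟨b, hb⟩ := IsLocalization.exist_integer_multiples_of_finset (nonZeroDivisors ℤ)
    (Finset.image (fun x : M × Fin n × Fin n => g x.1 x.2.1 x.2.2) (S ×ˢ Finset.univ))
  refine ⟨(b : ℤ).natAbs, Int.natAbs_ne_zero.mpr (nonZeroDivisors.coe_ne_zero b), ?_⟩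
  have key : ∀ x, ∃ B : Matrix (Fin n) (Fin n) ℤ, (b : ℤ) • g x = (Int.castRingHom ℚ).mapMatrix B := by
    intro x
    have hx : x ∈ Submodule.span ℤ (S : Set M) := hS ▸ Submodule.mem_top
    induction hx using Submodule.span_induction with
    | mem x hx =>
      have h1 : ∀ i j, ∃ z : ℤ, (z : ℚ) = (b : ℤ) • g x i j := by
        intro i j
        obtain ⟨z, hz⟩ := hb (g x i j) (Finset.mem_image.mpr ⟨(x, i, j), by simpa using hx, rfl⟩)
        exact ⟨z, hz⟩
      choose B hB using h1
      refine ⟨Matrix.of B, ?_⟩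
      ext i j
      simpa using (hB i j).symm
    | zero => exact ⟨0, by simp⟩
    | add x y _ _ hx hy =>
      obtain ⟨B, hB⟩ := hx
      obtain ⟨C, hC⟩ := hy
      exact ⟨B + C, by rw [map_add, smul_add, hB, hC, map_add]⟩
    | smul a x _ hx =>
      obtain ⟨B, hB⟩ := hx
      exact ⟨a • B, by rw [map_zsmul, smul_comm, hB, map_zsmul]⟩
  intro x
  obtain ⟨B, hB⟩ := key x
  rw [map_nsmul, ← natCast_zsmul]
  rcases Int.natAbs_eq (b : ℤ) with h | h
  · exact ⟨B, by rw [← h, hB]⟩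
  · refine ⟨-B, ?_⟩
    have h' : ((b : ℤ).natAbs : ℤ) = -(b : ℤ) := by omega
    rw [h', neg_smul, hB, map_neg]

/-- **Dirichlet's unit theorem in the matrix form.**
Let `A` be an `n × n` integer matrix whose characteristic polynomial is irreducible over `ℚ`,
with `s` real eigenvalues and `2t` non-real complex eigenvalues (`n = s + 2t`).
Then there exists a finite abelian group `G` such that `Ξ(A) ≅ G × ℤ^(s+t-1)`. -/
theorem dirichlet_group_structure
    (n : ℕ) (A : Matrix (Fin n) (Fin n) ℤ)
    (hA : Irreducible (A.charpoly.map (Int.castRingHom ℚ)))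
    (s t : ℕ)
    (hs : (A.charpoly.map (Int.castRingHom ℝ)).roots.card = s)
    (hst : (A.charpoly.map (Int.castRingHom ℂ)).roots.card = s + 2 * t) :
    ∃ (G : Type) (_ : CommGroup G) (_ : Finite G),
      Nonempty (dirichletGroup A ≃* (G × Multiplicative (Fin (s + t - 1) → ℤ))) := by
  classical
  have hF : Fact (Irreducible (A.charpoly.map (Int.castRingHom ℚ))) := ⟨hA⟩
  have hdeg : (A.charpoly.map (Int.castRingHom ℚ)).natDegree = n := by
    rw [← Matrix.charpoly_map, Matrix.charpoly_natDegree_eq_dim, Fintype.card_fin]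
  have hn : 0 < n := hdeg ▸ hA.natDegree_pos
  have : Nonempty (Fin n) := ⟨⟨0, hn⟩⟩
  let K := AdjoinRoot (A.charpoly.map (Int.castRingHom ℚ))
  let pb := AdjoinRoot.powerBasis hA.ne_zero
  have hfd : FiniteDimensional ℚ K := pb.finite
  have hcz : CharZero K := algebraRat.charZero K
  have hNF : NumberField K := { to_charZero := hcz, to_finiteDimensional := by convert hfd }
  have hfr : Module.finrank ℚ K = n := by
    have : Module.finrank ℚ K = n := by
      rw [pb.finrank, AdjoinRoot.powerBasis_dim, hdeg]
    convert this
  -- the rank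
  have hreal : InfinitePlace.nrRealPlaces K = s := by
    rw [← hs, nrReal_adjoinRoot, aroots, Polynomial.map_map]
    congr 3
  have hcn : s + 2 * t = n := by
    rw [← hst, ← IsAlgClosed.splits _ |>.natDegree_eq_card_roots,
      A.charpoly_monic.natDegree_map, Matrix.charpoly_natDegree_eq_dim, Fintype.card_fin]
  have hrank : Units.rank K = s + t - 1 := by
    have h1 := InfinitePlace.card_add_two_mul_card_eq_rank K
    have h2 := InfinitePlace.card_eq_nrRealPlaces_add_nrComplexPlaces K
    rw [Units.rank, h2]
    have h3 : Module.finrank ℚ K = n := by convert hfr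
    omega
  have hfin := Units.finrank_eq K
  rw [hrank] at hfin
  rw [← hfin]
  let c : Matrix (Fin n) (Fin n) ℤ →+* Matrix (Fin n) (Fin n) ℚ := (Int.castRingHom ℚ).mapMatrix
  have hcinj : Function.Injective c := Matrix.map_injective (Int.cast_injective)
  let φ : K →+* Matrix (Fin n) (Fin n) ℚ := (toMat A : K →ₐ[ℚ] _)
  have hφinj : Function.Injective φ := φ.injective
  let φO : 𝓞 K →+* Matrix (Fin n) (Fin n) ℚ := φ.comp (algebraMap (𝓞 K) K)
  have hφOinj : Function.Injective φO := hφinj.comp RingOfIntegers.coe_injective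
  let j : (𝓞 K)ˣ →* (Matrix (Fin n) (Fin n) ℚ)ˣ := Units.map φO
  have hj : Function.Injective j := Units.map_injective hφOinj
  let g : dirichletGroup A →* (Matrix (Fin n) (Fin n) ℚ)ˣ :=
    (Units.map (c : _ →* _)).comp (dirichletGroup A).subtype
  have hg : Function.Injective g := (Units.map_injective hcinj).comp Subtype.val_injective
  have hint : ∀ B : Matrix (Fin n) (Fin n) ℤ, Commute B A → ∃ x : 𝓞 K, φO x = c B := by
    intro B hB
    obtain ⟨x, hx⟩ := toMat_range A hA (c B) (hB.map c)
    have h1 : IsIntegral ℤ (φ x) := by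
      have : φ x = c B := hx
      rw [this]
      exact (Matrix.isIntegral B).map c.toIntAlgHom
    have h2 : IsIntegral ℤ x := (isIntegral_algHom_iff φ.toIntAlgHom hφinj).mp h1
    exact ⟨⟨x, h2⟩, hx⟩
  have hrange : g.range ≤ j.range := by
    rintro _ ⟨B, rfl⟩
    obtain ⟨x, hx⟩ := hint B.1.1 B.2
    obtain ⟨y, hy⟩ := hint (B⁻¹).1.1 (B⁻¹).2
    have hxy : x * y = 1 := hφOinj (by
      rw [map_mul, hx, hy, map_one, ← map_mul, ← Units.val_mul, ← Subgroup.coe_mul,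
        mul_inv_cancel, Subgroup.coe_one, Units.val_one, map_one])
    exact ⟨Units.mkOfMulEqOne x y hxy, Units.ext hx⟩
  let H : Subgroup (𝓞 K)ˣ := g.range.comap j
  have e1 : dirichletGroup A ≃* H :=
    (MonoidHom.ofInjective hg).trans ((MulEquiv.subgroupCongr
      (Subgroup.map_comap_eq_self hrange).symm).trans (H.equivMapOfInjective j hj).symm)
  obtain ⟨m, hm, hmB⟩ := exists_denom (φO : 𝓞 K →+ Matrix (Fin n) (Fin n) ℚ)
  let I : Ideal (𝓞 K) := Ideal.span {(m : 𝓞 K)}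
  have hI : I ≠ ⊥ := by
    rw [Ne, Ideal.span_singleton_eq_bot]
    exact_mod_cast hm
  have hIfin : Finite (𝓞 K ⧸ I) := Ring.HasFiniteQuotients.finiteQuotient hI
  have hIB : ∀ x : 𝓞 K, Ideal.Quotient.mk I x = 1 → ∃ B, φO x = c B := by
    intro x hx
    rw [← map_one (Ideal.Quotient.mk I), Ideal.Quotient.eq, Ideal.mem_span_singleton] at hx
    obtain ⟨y, hy⟩ := hx
    obtain ⟨B, hB⟩ := hmB y
    refine ⟨B + 1, ?_⟩
    rw [eq_add_of_sub_eq hy, map_add, map_add, map_one, map_one, ← nsmul_eq_mul]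
    exact congrArg (· + 1) hB
  have hker : ∀ u : (𝓞 K)ˣ, Units.map (Ideal.Quotient.mk I : 𝓞 K →* 𝓞 K ⧸ I) u = 1 → u ∈ H := by
    intro u hu
    obtain ⟨B, hB⟩ := hIB u (congrArg Units.val hu)
    obtain ⟨C, hC⟩ := hIB (u⁻¹ : (𝓞 K)ˣ) (congrArg Units.val (show Units.map (Ideal.Quotient.mk I : 𝓞 K →* 𝓞 K ⧸ I) u⁻¹ = 1 by rw [map_inv, hu, inv_one]))
    have hBC : B * C = 1 := hcinj (by
      rw [map_mul, ← hB, ← hC, ← map_mul, Units.mul_inv, map_one, map_one])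
    have hcom : Commute B A := hcinj (by
      rw [map_mul, map_mul, ← hB]
      exact toMat_comm A _)
    refine ⟨⟨⟨B, C, hBC, mul_eq_one_comm.mp hBC⟩, hcom⟩, Units.ext hB.symm⟩
  obtain ⟨T, i1, i2, ⟨e2⟩⟩ := fg_structure H (Nat.card (𝓞 K ⧸ I)ˣ) Nat.card_pos.ne' (fun u =>
    hker _ (by rw [map_pow, pow_card_eq_one']))
  exact ⟨T, i1, i2, ⟨e1.trans e2⟩⟩
end

section
/- For Lebesgue-almost every real number x ∈ (0,1), for every positive integer k, the asymptotic frequency of the element k among the partial quotients a₁(x), a₂(x), … of the regular continued fraction expansion of x exists and equals (1/ln 2)·ln(1 + 1/(k(k+2))), i.e., lim_{n→∞} (1/n)·#{ 1 ≤ i ≤ n : a_i(x) = k } = log₂(1 + 1/(k(k+2))). -/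
open MeasureTheory Filter

namespace GK

/-- Abstract strong law from exponential decay of correlations. -/
theorem second_moment {Ω : Type*} [MeasurableSpace Ω] {ν : Measure Ω} [IsProbabilityMeasure ν]
    {T : Ω → Ω} (hT : MeasurePreserving T ν ν) {Y : Ω → ℝ} (hY : Measurable Y)
    (hb : ∀ x, |Y x| ≤ 1) {C : ℝ} {θ : ℝ} (h0 : 0 ≤ θ) (h1 : θ < 1) (hC : 0 ≤ C)
    (hcov : ∀ n, ∫ x, Y x * Y (T^[n+1] x) ∂ν ≤ C * θ ^ n) (n : ℕ) :
    ∫ x, (∑ i ∈ Finset.range n, Y (T^[i] x)) ^ 2 ∂ν ≤ (1 + 2 * C / (1 - θ)) * n := by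
  have hm : ∀ i, Measurable (fun x => Y (T^[i] x)) := fun i => hY.comp (hT.measurable.iterate i)
  have hSm : ∀ n, Measurable (fun x => ∑ i ∈ Finset.range n, Y (T^[i] x)) := fun n =>
    Finset.measurable_sum _ (fun i _ => hm i)
  have hSb : ∀ n x, |∑ i ∈ Finset.range n, Y (T^[i] x)| ≤ n := fun n x => by
    refine (Finset.abs_sum_le_sum_abs _ _).trans ?_
    refine (Finset.sum_le_sum (fun i _ => hb (T^[i] x))).trans ?_
    simp
  have bint : ∀ (f : Ω → ℝ) (c : ℝ), Measurable f → (∀ x, |f x| ≤ c) → Integrable f ν := by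
    intro f c hf hc
    exact Integrable.of_bound hf.aestronglyMeasurable c (Eventually.of_forall hc)
  induction n with
  | zero => simp
  | succ n ih =>
    have key : ∀ x, (∑ i ∈ Finset.range (n+1), Y (T^[i] x)) ^ 2
        = Y x ^ 2 + 2 * ∑ i ∈ Finset.range n, Y x * Y (T^[i+1] x)
          + (∑ i ∈ Finset.range n, Y (T^[i] (T x))) ^ 2 := by
      intro x
      rw [Finset.sum_range_succ', ← Finset.mul_sum]
      simp only [Function.iterate_succ_apply, Function.iterate_zero, id]
      ring
    have i1 : Integrable (fun x => Y x ^ 2) ν := bint _ 1 (hY.pow_const 2) (fun x => by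
      rw [abs_pow]; exact pow_le_one₀ (abs_nonneg _) (hb x))
    have i2 : ∀ i, Integrable (fun x => Y x * Y (T^[i+1] x)) ν := fun i =>
      bint _ 1 (hY.mul (hm _)) (fun x => by
        rw [abs_mul]; exact mul_le_one₀ (hb x) (abs_nonneg _) (hb _))
    have i3 : Integrable (fun x => (∑ i ∈ Finset.range n, Y (T^[i] (T x))) ^ 2) ν :=
      bint _ (n^2) (((hSm n).comp hT.measurable).pow_const 2) (fun x => by
        rw [abs_pow]; exact pow_le_pow_left₀ (abs_nonneg _) (hSb n _) 2)
    have i4 : Integrable (fun x => ∑ i ∈ Finset.range n, Y x * Y (T^[i+1] x)) ν :=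
      integrable_finsetSum _ (fun i _ => i2 i)
    have i12 : Integrable (fun x => Y x ^ 2 + 2 * ∑ i ∈ Finset.range n, Y x * Y (T^[i+1] x)) ν :=
      i1.add (i4.const_mul 2)
    simp_rw [key]
    rw [integral_add i12 i3, integral_add i1 (i4.const_mul 2),
      integral_const_mul, integral_finsetSum _ (fun i _ => i2 i)]
    have e3 : ∫ x, (∑ i ∈ Finset.range n, Y (T^[i] (T x))) ^ 2 ∂ν
        = ∫ x, (∑ i ∈ Finset.range n, Y (T^[i] x)) ^ 2 ∂ν := by
      have := integral_map (μ := ν) (φ := T) hT.measurable.aemeasurable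
        (f := fun x => (∑ i ∈ Finset.range n, Y (T^[i] x)) ^ 2)
        ((hSm n).pow_const 2).aestronglyMeasurable
      rw [hT.map_eq] at this
      exact this.symm
    rw [e3]
    have e1 : ∫ x, Y x ^ 2 ∂ν ≤ 1 := by
      have : ∫ x, Y x ^ 2 ∂ν ≤ ∫ x, (1:ℝ) ∂ν := integral_mono i1 (integrable_const _) (fun x => by
        have := hb x
        rw [← sq_abs]; exact pow_le_one₀ (abs_nonneg _) (hb x))
      simpa using this
    have e2 : ∑ i ∈ Finset.range n, ∫ x, Y x * Y (T^[i+1] x) ∂ν ≤ C / (1 - θ) := by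
      refine (Finset.sum_le_sum (fun i _ => hcov i)).trans ?_
      rw [← Finset.mul_sum, div_eq_mul_inv]
      refine mul_le_mul_of_nonneg_left ?_ hC
      rw [← tsum_geometric_of_lt_one h0 h1]
      exact (summable_geometric_of_lt_one h0 h1).sum_le_tsum _ (fun i _ => by positivity)
    push_cast
    have : 2 * C / (1 - θ) = 2 * (C / (1 - θ)) := by ring
    rw [this] at ih ⊢
    linarith

theorem slln {Ω : Type*} [MeasurableSpace Ω] {ν : Measure Ω} [IsProbabilityMeasure ν]
    {T : Ω → Ω} (hT : MeasurePreserving T ν ν) {A : Set Ω} (hA : MeasurableSet A)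
    {C : ℝ} {θ : ℝ} (h0 : 0 ≤ θ) (h1 : θ < 1) (hC : 0 ≤ C)
    (hcov : ∀ n, ν.real (A ∩ T^[n+1] ⁻¹' A) ≤ ν.real A ^ 2 + C * θ ^ n) :
    ∀ᵐ x ∂ν, Tendsto (fun n : ℕ => (∑ i ∈ Finset.range n, A.indicator (fun _ => (1:ℝ)) (T^[i] x)) / n)
      atTop (nhds (ν.real A)) := by
  set a := ν.real A with ha
  set I : Ω → ℝ := A.indicator (fun _ => (1:ℝ)) with hI
  have hIm : Measurable I := measurable_const.indicator hA
  have hI01 : ∀ x, 0 ≤ I x ∧ I x ≤ 1 := fun x => by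
    by_cases h : x ∈ A <;> simp [hI, h]
  have ha0 : 0 ≤ a := measureReal_nonneg
  have ha1 : a ≤ 1 := measureReal_le_one
  set Y : Ω → ℝ := fun x => I x - a with hYd
  have hY : Measurable Y := hIm.sub_const a
  have hb : ∀ x, |Y x| ≤ 1 := fun x => by
    have := hI01 x
    rw [abs_le]; constructor <;> simp only [hYd] <;> linarith
  have hTn : ∀ n, MeasurePreserving (T^[n]) ν ν := fun n => hT.iterate n
  have hcov' : ∀ n, ∫ x, Y x * Y (T^[n+1] x) ∂ν ≤ C * θ ^ n := by
    intro n
    have hB : MeasurableSet (T^[n+1] ⁻¹' A) := (hTn _).measurable hA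
    have e : ∀ x, Y x * Y (T^[n+1] x) = (A ∩ T^[n+1] ⁻¹' A).indicator (fun _ => (1:ℝ)) x
        - a * I x - a * (T^[n+1] ⁻¹' A).indicator (fun _ => (1:ℝ)) x + a^2 := by
      intro x
      by_cases h : x ∈ A <;> by_cases h' : T^[n+1] x ∈ A <;>
        simp [hYd, hI, h, h', Set.indicator, -Function.iterate_succ] <;> ring
    simp_rw [e]
    have j1 : Integrable ((A ∩ T^[n+1] ⁻¹' A).indicator (fun _ => (1:ℝ))) ν :=
      (integrable_const _).indicator (hA.inter hB)
    have j2 : Integrable I ν := (integrable_const _).indicator hA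
    have j3 : Integrable ((T^[n+1] ⁻¹' A).indicator (fun _ => (1:ℝ))) ν :=
      (integrable_const _).indicator hB
    have j12 : Integrable (fun x => (A ∩ T^[n+1] ⁻¹' A).indicator (fun _ => (1:ℝ)) x - a * I x) ν :=
      j1.sub (j2.const_mul a)
    have j123 : Integrable (fun x => (A ∩ T^[n+1] ⁻¹' A).indicator (fun _ => (1:ℝ)) x - a * I x
        - a * (T^[n+1] ⁻¹' A).indicator (fun _ => (1:ℝ)) x) ν := j12.sub (j3.const_mul a)
    rw [integral_add j123 (integrable_const _),
      integral_sub j12 (j3.const_mul a), integral_sub j1 (j2.const_mul a),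
      integral_const_mul, integral_const_mul, hI, integral_indicator_const _ hA,
      integral_indicator_const _ hB, integral_indicator_const _ (hA.inter hB)]
    have : ν.real (T^[n+1] ⁻¹' A) = a := by
      rw [measureReal_def, (hTn (n+1)).measure_preimage hA.nullMeasurableSet]; rfl
    rw [this]
    have := hcov n
    simp only [smul_eq_mul, mul_one, integral_const, probReal_univ]
    nlinarith
  have hsm := second_moment hT hY hb h0 h1 hC hcov'
  set K := 1 + 2 * C / (1 - θ)
  have hm : ∀ i, Measurable (fun x => Y (T^[i] x)) := fun i => hY.comp (hT.measurable.iterate i)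
  have hSm : ∀ n, Measurable (fun x => ∑ i ∈ Finset.range n, Y (T^[i] x)) := fun n =>
    Finset.measurable_sum _ (fun i _ => hm i)
  have hSb : ∀ n x, |∑ i ∈ Finset.range n, Y (T^[i] x)| ≤ n := fun n x => by
    refine (Finset.abs_sum_le_sum_abs _ _).trans ?_
    refine (Finset.sum_le_sum (fun i _ => hb (T^[i] x))).trans ?_
    simp
  -- along squares
  have hsq : ∀ᵐ x ∂ν, Tendsto (fun m : ℕ =>
      ((∑ i ∈ Finset.range ((m+1)^2), Y (T^[i] x)) / ((m+1)^2 : ℕ)) ^ 2) atTop (nhds 0) := by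
    set Z : ℕ → Ω → ℝ := fun m x =>
      ((∑ i ∈ Finset.range ((m+1)^2), Y (T^[i] x)) / ((m+1)^2 : ℕ)) ^ 2 with hZ
    have hZm : ∀ m, Measurable (Z m) := fun m => ((hSm _).div_const _).pow_const 2
    have hZ0 : ∀ m x, 0 ≤ Z m x := fun m x => sq_nonneg _
    have hZi : ∀ m, Integrable (Z m) ν := fun m => by
      refine Integrable.of_bound (hZm m).aestronglyMeasurable 1 (Eventually.of_forall fun x => ?_)
      rw [Real.norm_eq_abs, hZ, abs_pow, abs_div]
      refine pow_le_one₀ (by positivity) ?_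
      refine div_le_one_of_le₀ ?_ (abs_nonneg _)
      exact (hSb _ x).trans (le_abs_self _)
    have hZe : ∀ m, ∫ x, Z m x ∂ν ≤ K * (1 / ((m:ℝ)+1)^2) := fun m => by
      have hz : ∀ x, Z m x = (1 / ((m:ℝ)+1)^4) * (∑ i ∈ Finset.range ((m+1)^2), Y (T^[i] x))^2 := by
        intro x; simp only [hZ]; push_cast; field_simp
      simp_rw [hz]
      rw [integral_const_mul]
      have := hsm ((m+1)^2)
      have hp : (0:ℝ) ≤ 1 / ((m:ℝ)+1)^4 := by positivity
      refine (mul_le_mul_of_nonneg_left this hp).trans (le_of_eq ?_)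
      push_cast; field_simp
    have hKs : Summable (fun m : ℕ => K * (1 / ((m:ℝ)+1)^2)) := by
      refine Summable.mul_left _ ?_
      have := (summable_nat_add_iff 1).2 (Real.summable_one_div_nat_pow.2 (one_lt_two))
      simpa using this
    have hfin : ∫⁻ x, ∑' m, ENNReal.ofReal (Z m x) ∂ν ≠ ⊤ := by
      rw [lintegral_tsum (fun m => (hZm m).ennreal_ofReal.aemeasurable)]
      have : ∀ m, ∫⁻ x, ENNReal.ofReal (Z m x) ∂ν ≤ ENNReal.ofReal (K * (1 / ((m:ℝ)+1)^2)) := by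
        intro m
        rw [← ofReal_integral_eq_lintegral_ofReal (hZi m) (Eventually.of_forall (hZ0 m))]
        exact ENNReal.ofReal_le_ofReal (hZe m)
      refine ne_top_of_le_ne_top ?_ (ENNReal.tsum_le_tsum this)
      exact hKs.tsum_ofReal_ne_top
    have hmeas : Measurable (fun x => ∑' m, ENNReal.ofReal (Z m x)) :=
      Measurable.tsum (fun m => (hZm m).ennreal_ofReal)
    filter_upwards [ae_lt_top hmeas hfin] with x hx
    have := ENNReal.tendsto_atTop_zero_of_tsum_ne_top hx.ne
    have h2 := (ENNReal.tendsto_toReal ENNReal.zero_ne_top).comp this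
    refine h2.congr (fun m => ?_)
    exact ENNReal.toReal_ofReal (hZ0 m x)
  filter_upwards [hsq] with x hx
  have hx' : Tendsto (fun m : ℕ =>
      ((∑ i ∈ Finset.range ((m+1)^2), Y (T^[i] x)) / ((m+1)^2 : ℕ))) atTop (nhds 0) := by
    have := hx.sqrt
    simp only [Real.sqrt_sq_eq_abs, Real.sqrt_zero] at this
    exact tendsto_zero_iff_abs_tendsto_zero _ |>.2 this
  refine tendsto_div_of_monotone_of_exists_subseq_tendsto_div _ _ ?_ ?_
  · refine monotone_nat_of_le_succ (fun n => ?_)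
    rw [Finset.sum_range_succ]
    linarith [(hI01 (T^[n] x)).1]
  · intro b hb1
    refine ⟨fun m => (m+1)^2, ?_, ?_, ?_⟩
    · have : Tendsto (fun m : ℕ => (1 + 1 / ((m:ℝ)+1))^2) atTop (nhds ((1+0)^2)) :=
        (tendsto_const_nhds.add tendsto_one_div_add_atTop_nhds_zero_nat).pow 2
      rw [add_zero, one_pow] at this
      filter_upwards [this.eventually (gt_mem_nhds hb1)] with m hm
      push_cast
      have h3 : ((m:ℝ)+1+1)^2 = (1 + 1 / ((m:ℝ)+1))^2 * ((m:ℝ)+1)^2 := by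
        field_simp
      rw [h3]
      exact mul_le_mul_of_nonneg_right hm.le (by positivity)
    · exact (tendsto_pow_atTop two_ne_zero).comp (tendsto_add_atTop_nat 1)
    · have := hx'.add_const a
      rw [zero_add] at this
      refine this.congr (fun m => ?_)
      simp only [hYd, Finset.sum_sub_distrib, Finset.sum_const, Finset.card_range, nsmul_eq_mul]
      have : (((m+1)^2 : ℕ) : ℝ) ≠ 0 := by positivity
      field_simp
      ring
end GK

namespace GK
noncomputable section

/-- transition weights -/
def p (k : ℕ) (t : ℝ) : ℝ := (1 + t) / ((k + 1 + t) * (k + 2 + t))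

theorem p_nonneg (k : ℕ) {t : ℝ} (ht : 0 ≤ t) : 0 ≤ p k t := by
  unfold p; positivity

theorem p_le (k : ℕ) {t : ℝ} (ht : 0 ≤ t) (h1 : t ≤ 1) :
    p k t ≤ 2 / (((k:ℝ) + 1) * (k + 2)) := by
  unfold p
  have hk : (0:ℝ) ≤ k := k.cast_nonneg
  exact div_le_div₀ (by positivity) (by linarith) (by positivity)
            (mul_le_mul (by linarith) (by linarith) (by positivity) (by positivity))

theorem p_summable {t : ℝ} (ht : 0 ≤ t) (h1 : t ≤ 1) : Summable (fun k => p k t) := by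
  have h := (summable_nat_add_iff 1).2 (Real.summable_one_div_nat_pow.2 (one_lt_two))
  refine Summable.of_nonneg_of_le (fun k => p_nonneg k ht) (fun k => ?_) (h.mul_left 2)
  refine (p_le k ht h1).trans ?_
  push_cast
  rw [mul_one_div]
  have hk : (0:ℝ) ≤ k := k.cast_nonneg
  gcongr
  nlinarith

theorem p_sum (n : ℕ) {t : ℝ} (ht : 0 ≤ t) :
    ∑ k ∈ Finset.range n, p k t = 1 - (1 + t) / (n + 1 + t) := by
  induction n with
  | zero => simp; field_simp; simp
  | succ n ih =>
    rw [Finset.sum_range_succ, ih]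
    unfold p
    have hk : (0:ℝ) ≤ n := n.cast_nonneg
    push_cast
    have h1 : (n:ℝ) + 1 + t ≠ 0 := by positivity
    have h2 : (n:ℝ) + 2 + t ≠ 0 := by positivity
    have h3 : (n:ℝ) + 1 + 1 + t ≠ 0 := by positivity
    field_simp
    ring

theorem tendsto_Q {t : ℝ} : Tendsto (fun n : ℕ => (1 + t) / ((n:ℝ) + 1 + t)) atTop (nhds 0) := by
  refine Tendsto.div_atTop tendsto_const_nhds ?_
  have : Tendsto (fun n : ℕ => (n:ℝ) + (1 + t)) atTop atTop :=
    tendsto_atTop_add_const_right _ _ tendsto_natCast_atTop_atTop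
  simpa [add_assoc] using this

theorem p_tsum {t : ℝ} (ht : 0 ≤ t) (h1 : t ≤ 1) : ∑' k, p k t = 1 := by
  have h := (p_summable ht h1).hasSum.tendsto_sum_nat
  have h' : Tendsto (fun n => ∑ k ∈ Finset.range n, p k t) atTop (nhds (1 - 0)) := by
    simp_rw [p_sum _ ht]
    exact tendsto_const_nhds.sub tendsto_Q
  rw [sub_zero] at h'
  exact tendsto_nhds_unique h h'

theorem inv_mem (k : ℕ) {t : ℝ} (ht : 0 ≤ t) :
    0 ≤ ((k:ℝ) + 1 + t)⁻¹ ∧ ((k:ℝ) + 1 + t)⁻¹ ≤ 1 := by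
  have hk : (0:ℝ) ≤ k := k.cast_nonneg
  refine ⟨by positivity, inv_le_one_of_one_le₀ (by linarith)⟩

def Lip (L : ℝ) (f : ℝ → ℝ) : Prop :=
  ∀ x y, 0 ≤ x → x ≤ 1 → 0 ≤ y → y ≤ 1 → |f x - f y| ≤ L * |x - y|

theorem Lip.bdd {L : ℝ} {f : ℝ → ℝ} (hL : 0 ≤ L) (h : Lip L f) {x : ℝ} (h0 : 0 ≤ x) (h1 : x ≤ 1) :
    |f x| ≤ |f 0| + L := by
  have := h x 0 h0 h1 le_rfl zero_le_one
  have h2 : |f x| ≤ |f x - f 0| + |f 0| := by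
    have := abs_add_le (f x - f 0) (f 0); simpa using this
  have h3 : L * |x - 0| ≤ L * 1 := by
    apply mul_le_mul_of_nonneg_left _ hL
    rw [sub_zero, abs_of_nonneg h0]; exact h1
  linarith

theorem pf_summable {L : ℝ} {f : ℝ → ℝ} (hL : 0 ≤ L) (h : Lip L f) {t : ℝ} (ht : 0 ≤ t)
    (h1 : t ≤ 1) : Summable (fun k : ℕ => p k t * f (((k:ℝ) + 1 + t)⁻¹)) := by
  refine Summable.of_norm_bounded ((p_summable ht h1).mul_right (|f 0| + L)) (fun k => ?_)
  rw [Real.norm_eq_abs, abs_mul, abs_of_nonneg (p_nonneg k ht)]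
  have := inv_mem k ht
  exact mul_le_mul_of_nonneg_left (h.bdd hL this.1 this.2) (p_nonneg k ht)

theorem aux_step {M : ℝ} (hM : 0 ≤ M) :
    (2 / ((M + 2) ^ 3 * (M + 3)) + 1 / (M+2)^3)
        ≤ (5/6) / ((M+1) * (M+2)) - 5 / 6 / ((M + 2) * (M + 3)) := by
  have l : (2 / ((M + 2) ^ 3 * (M + 3)) + 1 / (M+2)^3)
    = (M + 5) / ((M + 2) ^ 3 * (M + 3)) := by field_simp; ring
  have r : (5/6) / ((M+1) * (M+2)) - 5 / 6 / ((M + 2) * (M + 3))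
    = (5/3) / ((M+1) * (M+2) * (M+3)) := by field_simp; ring
  rw [l, r, div_le_div_iff₀ (by positivity) (by positivity)]
  have h1 : 0 ≤ (5/3) * (M+2)^2 - (M+5) * (M+1) := by nlinarith
  have h2 : 0 ≤ (M+2) * (M+3) * ((5/3) * (M+2)^2 - (M+5) * (M+1)) := by positivity
  have h3 : (M+2) * (M+3) * ((5/3) * (M+2)^2 - (M+5) * (M+1))
    = 5 / 3 * ((M + 2) ^ 3 * (M + 3)) - (M + 5) * ((M + 1) * (M + 2) * (M + 3)) := by ring
  linarith

theorem finite_bound {L : ℝ} {f : ℝ → ℝ} (hL : 0 ≤ L) (h : Lip L f) {x y : ℝ} (hx : 0 ≤ x)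
    (hx1 : x ≤ 1) (hy : 0 ≤ y) (hy1 : y ≤ 1) (N : ℕ) :
    |∑ k ∈ Finset.range (N+1), (p k x * f (((k:ℝ) + 1 + x)⁻¹) - p k y * f (((k:ℝ) + 1 + y)⁻¹))
      + ((1 + x) / (((N+1:ℕ):ℝ) + 1 + x) - (1 + y) / (((N+1:ℕ):ℝ) + 1 + y)) * f (((N:ℝ) + 1 + y)⁻¹)|
    ≤ (11/12 - (5/6) / (((N:ℝ)+1) * (N+2))) * (L * |x - y|) := by
  have hinv : ∀ a b : ℝ, 0 < a → 0 < b → a⁻¹ - b⁻¹ = (b - a) / (a * b) := by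
    intro a b ha hb; field_simp
  have hM : 0 ≤ L * |x - y| := by positivity
  -- Lipschitz bound on branches
  have hbr : ∀ k : ℕ, |f (((k:ℝ) + 1 + x)⁻¹) - f (((k:ℝ) + 1 + y)⁻¹)|
      ≤ (L * |x - y|) / ((k:ℝ)+1)^2 := by
    intro k
    have a1 := inv_mem k hx
    have a2 := inv_mem k hy
    have hk : (0:ℝ) ≤ k := k.cast_nonneg
    refine (h _ _ a1.1 a1.2 a2.1 a2.2).trans ?_
    rw [hinv _ _ (by positivity) (by positivity), abs_div, mul_div_assoc]
    refine mul_le_mul_of_nonneg_left ?_ hL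
    have e : (k:ℝ) + 1 + y - (k + 1 + x) = -(x - y) := by ring
    rw [e, abs_neg, abs_of_pos (by positivity : 0 < ((k:ℝ) + 1 + x) * (k + 1 + y)), sq]
    exact div_le_div₀ (by positivity) (by linarith) (by positivity)
            (mul_le_mul (by linarith) (by linarith) (by positivity) (by positivity))
  induction N with
  | zero =>
    have e : p 0 x * f (((0:ℕ):ℝ) + 1 + x)⁻¹ - p 0 y * f (((0:ℕ):ℝ) + 1 + y)⁻¹
      + ((1 + x) / (((0+1:ℕ):ℝ) + 1 + x) - (1 + y) / (((0+1:ℕ):ℝ) + 1 + y)) * f (((0:ℕ):ℝ) + 1 + y)⁻¹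
      = p 0 x * (f ((((0:ℕ):ℝ) + 1 + x)⁻¹) - f ((((0:ℕ):ℝ) + 1 + y)⁻¹)) := by
      have h1 : p 0 x = 1 - (1 + x) / (((0+1:ℕ):ℝ) + 1 + x) := by
        have := p_sum 1 hx; simpa using this
      have h2 : p 0 y = 1 - (1 + y) / (((0+1:ℕ):ℝ) + 1 + y) := by
        have := p_sum 1 hy; simpa using this
      rw [h1, h2]; ring
    rw [zero_add, Finset.sum_range_one]
    rw [zero_add] at e
    rw [e, abs_mul, abs_of_nonneg (p_nonneg 0 hx)]
    have hp : p 0 x ≤ 1/2 := by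
      unfold p; rw [div_le_div_iff₀ (by positivity) (by norm_num)]; push_cast; nlinarith
    have h3 := hbr 0
    have h4 : p 0 x * |f ((((0:ℕ):ℝ) + 1 + x)⁻¹) - f ((((0:ℕ):ℝ) + 1 + y)⁻¹)|
        ≤ 1/2 * ((L * |x - y|) / (((0:ℕ):ℝ)+1)^2) :=
      mul_le_mul hp h3 (abs_nonneg _) (by norm_num)
    refine h4.trans (le_of_eq ?_)
    push_cast; ring
  | succ N ih =>
    have hN : (0:ℝ) ≤ N := N.cast_nonneg
    set S := ∑ k ∈ Finset.range (N+1),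
      (p k x * f (((k:ℝ) + 1 + x)⁻¹) - p k y * f (((k:ℝ) + 1 + y)⁻¹)) with hS
    set D1 := (1 + x) / (((N+1:ℕ):ℝ) + 1 + x) - (1 + y) / (((N+1:ℕ):ℝ) + 1 + y) with hD1
    set D2 := (1 + x) / (((N+1+1:ℕ):ℝ) + 1 + x) - (1 + y) / (((N+1+1:ℕ):ℝ) + 1 + y) with hD2
    rw [Finset.sum_range_succ, ← hS]
    set fx := f ((((N+1:ℕ):ℝ) + 1 + x)⁻¹) with hfx
    set fy := f ((((N+1:ℕ):ℝ) + 1 + y)⁻¹) with hfy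
    set f0 := f (((N:ℝ) + 1 + y)⁻¹) with hf0
    have hpD : p (N+1) x - p (N+1) y = D1 - D2 := by
      have q1 := p_sum (N+1) hx
      have q2 := p_sum (N+1+1) hx
      have q3 := p_sum (N+1) hy
      have q4 := p_sum (N+1+1) hy
      rw [Finset.sum_range_succ] at q2 q4
      rw [hD1, hD2]; linarith
    have e : S + (p (N+1) x * fx - p (N+1) y * fy) + D2 * fy
        = (S + D1 * f0) + p (N+1) x * (fx - fy) + D1 * (fy - f0) := by
      have : p (N+1) y = p (N+1) x - D1 + D2 := by linarith
      rw [this]; ring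
    rw [e]
    have b1 : |p (N+1) x * (fx - fy)| ≤ (2 / (((N:ℝ) + 2) * (N + 3))) * ((L * |x - y|) / ((N:ℝ)+2)^2) := by
      rw [abs_mul, abs_of_nonneg (p_nonneg _ hx)]
      have h1 := p_le (N+1) hx hx1
      have h2 := hbr (N+1)
      have c1 : (((N+1:ℕ):ℝ) + 1) = N + 2 := by push_cast; ring
      have c2 : (((N+1:ℕ):ℝ) + 2) = N + 3 := by push_cast; ring
      rw [c1, c2] at h1
      have h2' : |fx - fy| ≤ (L * |x - y|) / ((N:ℝ)+2)^2 := by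
        rw [← c1]; exact h2
      exact mul_le_mul h1 h2' (abs_nonneg _) (by positivity)
    have b2 : |D1 * (fy - f0)| ≤ (L * |x - y|) / ((N:ℝ)+2)^3 := by
      have hD : |D1| ≤ ((N:ℝ)+1) * |x - y| / ((N:ℝ)+2)^2 := by
        have : D1 = ((N:ℝ)+1) * (x - y) / ((N + 2 + x) * (N + 2 + y)) := by
          rw [hD1]; push_cast
          have h1 : (N:ℝ) + 1 + 1 + x ≠ 0 := by positivity
          have h2 : (N:ℝ) + 1 + 1 + y ≠ 0 := by positivity
          have h3 : (N:ℝ) + 2 + x ≠ 0 := by positivity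
          have h4 : (N:ℝ) + 2 + y ≠ 0 := by positivity
          field_simp
          ring
        rw [this, abs_div, abs_mul, abs_of_pos (by positivity : 0 < (N:ℝ)+1),
          abs_of_pos (by positivity : 0 < ((N:ℝ) + 2 + x) * (N + 2 + y)), sq]
        exact div_le_div₀ (by positivity) (by linarith) (by positivity)
            (mul_le_mul (by linarith) (by linarith) (by positivity) (by positivity))
      have hf : |fy - f0| ≤ L / (((N:ℝ)+1) * (N+2)) := by
        have a1 := inv_mem (N+1) hy
        have a2 := inv_mem N hy
        refine (h _ _ a1.1 a1.2 a2.1 a2.2).trans ?_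
        rw [hinv _ _ (by positivity) (by positivity), abs_div, div_eq_mul_one_div L]
        refine mul_le_mul_of_nonneg_left ?_ hL
        push_cast
        have e : (N:ℝ) + 1 + y - (N + 1 + 1 + y) = -1 := by ring
        rw [e, abs_neg, abs_one,
          abs_of_pos (by positivity : 0 < ((N:ℝ) + 1 + 1 + y) * (N + 1 + y))]
        rw [mul_comm ((N:ℝ)+1)]
        exact div_le_div₀ (by positivity) (by linarith) (by positivity)
            (mul_le_mul (by linarith) (by linarith) (by positivity) (by positivity))
      rw [abs_mul]
      refine (mul_le_mul hD hf (abs_nonneg _) (by positivity)).trans (le_of_eq ?_)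
      field_simp
    refine (abs_add_le _ _).trans ?_
    refine (add_le_add_left (abs_add_le _ _) _).trans ?_
    refine (add_le_add (add_le_add ih b1) b2).trans ?_
    have e2 : (11/12 - (5/6) / (((N:ℝ)+1) * (N+2))) * (L * |x - y|)
        + 2 / (((N:ℝ) + 2) * (N + 3)) * ((L * |x - y|) / ((N:ℝ)+2)^2) + (L * |x - y|) / ((N:ℝ)+2)^3
        = (11/12 - (5/6) / (((N:ℝ)+1) * (N+2)) + 2 / (((N:ℝ) + 2) ^ 3 * (N + 3)) + 1 / ((N:ℝ)+2)^3)
          * (L * |x - y|) := by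
      field_simp
    rw [e2]
    refine mul_le_mul_of_nonneg_right ?_ hM
    push_cast
    have e3 : (N:ℝ) + 1 + 1 = N + 2 := by ring
    have e4 : (N:ℝ) + 1 + 2 = N + 3 := by ring
    rw [e3, e4]
    have h5 := aux_step hN
    linarith

theorem lip_contract {L : ℝ} {f : ℝ → ℝ} (hL : 0 ≤ L) (h : Lip L f) :
    Lip (11/12 * L) (fun t => ∑' k : ℕ, p k t * f (((k:ℝ) + 1 + t)⁻¹)) := by
  intro x y hx hx1 hy hy1
  have sx := (pf_summable hL h hx hx1).hasSum.tendsto_sum_nat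
  have sy := (pf_summable hL h hy hy1).hasSum.tendsto_sum_nat
  have s := ((sx.sub sy).comp (tendsto_add_atTop_nat 1))
  have hD : Tendsto (fun N : ℕ => ((1 + x) / (((N+1:ℕ):ℝ) + 1 + x) - (1 + y) / (((N+1:ℕ):ℝ) + 1 + y))
      * f (((N:ℝ) + 1 + y)⁻¹)) atTop (nhds 0) := by
    have t1 := ((tendsto_Q (t := x)).sub (tendsto_Q (t := y))).comp (tendsto_add_atTop_nat 1)
    rw [sub_zero] at t1
    refine t1.zero_mul_isBoundedUnder_le ?_
    refine isBoundedUnder_of ⟨|f 0| + L, fun N => ?_⟩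
    have := inv_mem N hy
    exact h.bdd hL this.1 this.2
  have tot := (s.add hD).abs
  rw [add_zero] at tot
  refine le_of_tendsto tot (Eventually.of_forall fun N => ?_)
  have := finite_bound hL h hx hx1 hy hy1 N
  rw [Finset.sum_sub_distrib] at this
  refine this.trans ?_
  have : 0 ≤ (5/6) / (((N:ℝ)+1) * (N+2)) * (L * |x - y|) := by positivity
  nlinarith

theorem p_lip (k : ℕ) : Lip 2 (p k) := by
  intro x y hx hx1 hy hy1
  have hQ : ∀ n : ℕ, |(1 + x) / ((n:ℝ) + 1 + x) - (1 + y) / ((n:ℝ) + 1 + y)| ≤ |x - y| := by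
    intro n
    have hn : (0:ℝ) ≤ n := n.cast_nonneg
    have : (1 + x) / ((n:ℝ) + 1 + x) - (1 + y) / ((n:ℝ) + 1 + y)
        = (n / ((n + 1 + x) * (n + 1 + y))) * (x - y) := by
      have h1 : (n:ℝ) + 1 + x ≠ 0 := by positivity
      have h2 : (n:ℝ) + 1 + y ≠ 0 := by positivity
      field_simp; ring
    rw [this, abs_mul]
    refine mul_le_of_le_one_left (abs_nonneg _) ?_
    rw [abs_of_nonneg (by positivity)]
    refine div_le_one_of_le₀ ?_ (by positivity)
    nlinarith [mul_nonneg hn hx, mul_nonneg hn hy, mul_nonneg hx hy]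
  have e : p k x - p k y = ((1 + x) / ((k:ℝ) + 1 + x) - (1 + y) / ((k:ℝ) + 1 + y))
      - ((1 + x) / (((k+1:ℕ):ℝ) + 1 + x) - (1 + y) / (((k+1:ℕ):ℝ) + 1 + y)) := by
    have q1 := p_sum k hx
    have q2 := p_sum (k+1) hx
    have q3 := p_sum k hy
    have q4 := p_sum (k+1) hy
    rw [Finset.sum_range_succ] at q2 q4
    linarith
  rw [e]
  refine (abs_sub _ _).trans ?_
  linarith [hQ k, hQ (k+1)]

end
end GK

namespace GK
noncomputable section
open scoped ENNReal

def G (x : ℝ) : ℝ := Int.fract x⁻¹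

def w (x : ℝ) : ℝ≥0∞ := ENNReal.ofReal (1 / (Real.log 2 * (1 + x)))

def ν : Measure ℝ := (volume.restrict (Set.Ioo (0:ℝ) 1)).withDensity w

theorem w_meas : Measurable w := by
  unfold w; fun_prop

theorem G_meas : Measurable G := by
  unfold G; exact measurable_inv.fract

theorem p_meas (k : ℕ) : Measurable (p k) := by
  unfold p; fun_prop

def P (F : ℝ → ℝ≥0∞) (t : ℝ) : ℝ≥0∞ := ∑' k : ℕ, ENNReal.ofReal (p k t) * F (((k:ℝ) + 1 + t)⁻¹)

theorem P_meas {F : ℝ → ℝ≥0∞} (hF : Measurable F) : Measurable (P F) := by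
  unfold P
  refine Measurable.tsum (fun k => ?_)
  exact (p_meas k).ennreal_ofReal.mul (hF.comp (by fun_prop))

theorem image_branch (k : ℕ) : (fun t : ℝ => ((k:ℝ) + 1 + t)⁻¹) '' Set.Ico 0 1
    = {x | x ∈ Set.Ioc (0:ℝ) 1 ∧ ⌊x⁻¹⌋ = (k:ℤ) + 1} := by
  have hk : (0:ℝ) ≤ k := k.cast_nonneg
  ext x
  constructor
  · rintro ⟨t, ⟨h0, h1⟩, rfl⟩
    refine ⟨⟨by positivity, (inv_mem k h0).2⟩, ?_⟩
    simp only [inv_inv]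
    rw [Int.floor_eq_iff]
    push_cast
    constructor <;> linarith
  · rintro ⟨⟨h0, h1⟩, h⟩
    rw [Int.floor_eq_iff] at h
    push_cast at h
    refine ⟨x⁻¹ - (k + 1), ⟨by linarith, by linarith⟩, ?_⟩
    simp

theorem duality {F g : ℝ → ℝ≥0∞} (hF : Measurable F) (hg : Measurable g) :
    ∫⁻ x, F x * g (G x) ∂ν = ∫⁻ t, P F t * g t ∂ν := by
  have hl : 0 < Real.log 2 := Real.log_pos one_lt_two
  unfold ν
  have m1 : Measurable (fun x => F x * g (G x)) := hF.mul (hg.comp G_meas)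
  have m2 : Measurable (fun t => P F t * g t) := (P_meas hF).mul hg
  rw [lintegral_withDensity_eq_lintegral_mul _ w_meas m1,
    lintegral_withDensity_eq_lintegral_mul _ w_meas m2]
  simp only [Pi.mul_apply]
  have hU : Set.Ioc (0:ℝ) 1 = ⋃ k : ℕ, (fun t : ℝ => ((k:ℝ) + 1 + t)⁻¹) '' Set.Ico 0 1 := by
    ext x
    simp only [image_branch, Set.mem_iUnion, Set.mem_setOf_eq]
    constructor
    · intro hx
      have h1 : 1 ≤ x⁻¹ := (one_le_inv₀ hx.1).2 hx.2
      have h2 : 1 ≤ ⌊x⁻¹⌋ := Int.le_floor.2 (by simpa using h1)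
      refine ⟨(⌊x⁻¹⌋ - 1).toNat, hx, ?_⟩
      omega
    · rintro ⟨k, hx, _⟩; exact hx
  have hmeasB : ∀ k : ℕ, MeasurableSet ((fun t : ℝ => ((k:ℝ) + 1 + t)⁻¹) '' Set.Ico 0 1) := by
    intro k
    rw [image_branch]
    refine measurableSet_Ioc.inter ?_
    exact (measurable_inv.floor) (measurableSet_singleton _)
  have hdisj : Pairwise (Function.onFun Disjoint
      (fun k : ℕ => (fun t : ℝ => ((k:ℝ) + 1 + t)⁻¹) '' Set.Ico 0 1)) := by
    intro i j hij
    simp only [Function.onFun, image_branch]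
    rw [Set.disjoint_left]
    rintro x ⟨_, hi⟩ ⟨_, hj⟩
    apply hij
    have := hi.symm.trans hj
    omega
  rw [Measure.restrict_congr_set (Ioo_ae_eq_Ioc (μ := volume) (a := (0:ℝ)) (b := 1)), hU,
    lintegral_iUnion hmeasB hdisj, ← hU,
    ← Measure.restrict_congr_set (Ioo_ae_eq_Ioc (μ := volume) (a := (0:ℝ)) (b := 1)),
    Measure.restrict_congr_set (Ioo_ae_eq_Ico (μ := volume) (a := (0:ℝ)) (b := 1))]
  have step : ∀ k : ℕ, ∫⁻ x in (fun t : ℝ => ((k:ℝ) + 1 + t)⁻¹) '' Set.Ico 0 1, w x * (F x * g (G x))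
      = ∫⁻ t in Set.Ico (0:ℝ) 1, w t * (ENNReal.ofReal (p k t) * F (((k:ℝ) + 1 + t)⁻¹) * g t) := by
    intro k
    have hk : (0:ℝ) ≤ k := k.cast_nonneg
    rw [lintegral_image_eq_lintegral_abs_deriv_mul (f' := fun t => -1 / ((k:ℝ) + 1 + t)^2)
      measurableSet_Ico]
    · refine setLIntegral_congr_fun measurableSet_Ico (fun t ht => ?_)
      have h0 : 0 ≤ t := ht.1
      have hG : G (((k:ℝ) + 1 + t)⁻¹) = t := by
        unfold G
        rw [inv_inv, Int.fract_eq_iff]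
        exact ⟨ht.1, ht.2, k + 1, by push_cast; ring⟩
      simp only [hG]
      have hw : ENNReal.ofReal |-1 / ((k:ℝ) + 1 + t)^2| * w (((k:ℝ) + 1 + t)⁻¹)
          = w t * ENNReal.ofReal (p k t) := by
        unfold w p
        rw [← ENNReal.ofReal_mul (abs_nonneg _), ← ENNReal.ofReal_mul (by positivity)]
        congr 1
        rw [abs_div, abs_neg, abs_one, abs_of_pos (by positivity)]
        have h1 : (k:ℝ) + 1 + t ≠ 0 := by positivity
        have h2 : (k:ℝ) + 2 + t ≠ 0 := by positivity
        have h3 : 1 + t ≠ 0 := by positivity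
        have h4 : 1 + ((k:ℝ) + 1 + t)⁻¹ = (k + 2 + t) / (k + 1 + t) := by field_simp; ring
        rw [h4]
        field_simp
      rw [← mul_assoc, hw]
      ring
    · intro t ht
      have h0 : 0 ≤ t := ht.1
      have h1 : (k:ℝ) + 1 + t ≠ 0 := by positivity
      exact (((hasDerivAt_id t).const_add ((k:ℝ) + 1)).inv h1).hasDerivWithinAt
    · intro a _ b _ hab
      have := inv_injective hab
      linarith
  simp_rw [step]
  rw [← lintegral_tsum]
  · refine lintegral_congr (fun t => ?_)
    unfold P
    rw [← ENNReal.tsum_mul_right, ← ENNReal.tsum_mul_left]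
  · intro k
    exact (w_meas.mul (((p_meas k).ennreal_ofReal.mul (hF.comp (by fun_prop))).mul hg)).aemeasurable

theorem ν_Ioc {a b : ℝ} (ha : 0 ≤ a) (hab : a ≤ b) (hb : b ≤ 1) :
    ν (Set.Ioc a b) = ENNReal.ofReal (1 / Real.log 2 * Real.log ((1 + b) / (1 + a))) := by
  have hl : 0 < Real.log 2 := Real.log_pos one_lt_two
  unfold ν
  rw [Measure.restrict_congr_set (Ioo_ae_eq_Ioc (μ := volume) (a := (0:ℝ)) (b := 1)),
    withDensity_apply _ measurableSet_Ioc, Measure.restrict_restrict measurableSet_Ioc,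
    Set.inter_eq_left.2 (Set.Ioc_subset_Ioc ha hb)]
  unfold w
  have hc : ContinuousOn (fun x : ℝ => 1 / (Real.log 2 * (1 + x))) (Set.uIcc a b) := by
    rw [Set.uIcc_of_le hab]
    refine ContinuousOn.div continuousOn_const (by fun_prop) (fun x hx => ?_)
    have : 0 < 1 + x := by linarith [hx.1]
    positivity
  have hi : IntervalIntegrable (fun x : ℝ => 1 / (Real.log 2 * (1 + x))) volume a b :=
    hc.intervalIntegrable
  rw [← ofReal_integral_eq_lintegral_ofReal]
  · congr 1
    rw [← intervalIntegral.integral_of_le hab,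
      intervalIntegral.integral_eq_sub_of_hasDerivAt (f := fun x => 1 / Real.log 2 * Real.log (1 + x))
        _ hi]
    · rw [Real.log_div (by linarith) (by linarith)]; ring
    · intro x hx
      rw [Set.uIcc_of_le hab] at hx
      have h1 : 1 + x ≠ 0 := by linarith [hx.1]
      have := (((hasDerivAt_id x).const_add (1:ℝ)).log h1).const_mul (1 / Real.log 2)
      convert! this using 1
      simp only [id]
      field_simp
  · exact hi.1
  · filter_upwards [ae_restrict_mem measurableSet_Ioc] with x hx
    have : 0 < 1 + x := by linarith [hx.1]
    show (0:ℝ) ≤ _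
    positivity

theorem ν_ae_Ioo : ∀ᵐ x ∂ν, x ∈ Set.Ioo (0:ℝ) 1 :=
  (withDensity_absolutelyContinuous _ _).ae_le (ae_restrict_mem measurableSet_Ioo)

instance : IsProbabilityMeasure ν := by
  constructor
  have h : ν Set.univ = ν (Set.Ioc 0 1) := by
    refine measure_congr (eventuallyEq_set.2 ?_)
    filter_upwards [ν_ae_Ioo] with x hx
    exact ⟨fun _ => ⟨hx.1, hx.2.le⟩, fun _ => trivial⟩
  rw [h, ν_Ioc le_rfl zero_le_one le_rfl]
  have hl : 0 < Real.log 2 := Real.log_pos one_lt_two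
  norm_num

theorem P_one {t : ℝ} (h0 : 0 ≤ t) (h1 : t ≤ 1) : P (fun _ => 1) t = 1 := by
  unfold P
  simp only [mul_one]
  rw [← ENNReal.ofReal_tsum_of_nonneg (fun k => p_nonneg k h0) (p_summable h0 h1), p_tsum h0 h1]
  simp

theorem G_mp : MeasurePreserving G ν ν := by
  refine ⟨G_meas, ?_⟩
  ext s hs
  rw [Measure.map_apply G_meas hs]
  have h := duality (F := fun _ => 1) (g := s.indicator (fun _ => 1)) measurable_const
    (measurable_const.indicator hs)
  have e1 : ∫⁻ x, (1:ℝ≥0∞) * s.indicator (fun _ => 1) (G x) ∂ν = ν (G ⁻¹' s) := by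
    simp only [one_mul]
    rw [← lintegral_indicator_one (G_meas hs)]
    rfl
  have e2 : ∫⁻ t, P (fun _ => 1) t * s.indicator (fun _ => 1) t ∂ν = ν s := by
    rw [← lintegral_indicator_one hs]
    refine lintegral_congr_ae ?_
    filter_upwards [ν_ae_Ioo] with t ht
    rw [P_one ht.1.le ht.2.le, one_mul]
    rfl
  rw [← e1, h, e2]

def Good (L : ℝ) (F : ℝ → ℝ≥0∞) : Prop :=
  Measurable F ∧ ∃ f : ℝ → ℝ, Lip L f ∧ ∀ t, 0 ≤ t → t ≤ 1 → 0 ≤ f t ∧ F t = ENNReal.ofReal (f t)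

theorem Good.step {L : ℝ} (hL : 0 ≤ L) {F : ℝ → ℝ≥0∞} (h : Good L F) : Good (11/12 * L) (P F) := by
  obtain ⟨hm, f, hf, hFf⟩ := h
  refine ⟨P_meas hm, _, lip_contract hL hf, fun t h0 h1 => ?_⟩
  have hn : ∀ k : ℕ, 0 ≤ p k t * f (((k:ℝ) + 1 + t)⁻¹) := fun k =>
    mul_nonneg (p_nonneg k h0) (hFf _ (inv_mem k h0).1 (inv_mem k h0).2).1
  refine ⟨tsum_nonneg hn, ?_⟩
  rw [ENNReal.ofReal_tsum_of_nonneg hn (pf_summable hL hf h0 h1)]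
  unfold P
  refine tsum_congr (fun k => ?_)
  rw [(hFf _ (inv_mem k h0).1 (inv_mem k h0).2).2, ENNReal.ofReal_mul (p_nonneg k h0)]

/-- digit sets -/
def A (k : ℕ) : Set ℝ := {x | ⌊x⁻¹⌋ = (k:ℤ) + 1}

theorem A_meas (k : ℕ) : MeasurableSet (A k) :=
  (measurable_inv.floor) (measurableSet_singleton _)

def H (k : ℕ) (n : ℕ) : ℝ → ℝ≥0∞ := P^[n] (fun t => ENNReal.ofReal (p k t))

theorem H_good (k n : ℕ) : Good (2 * (11/12)^n) (H k n) := by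
  induction n with
  | zero =>
    refine ⟨(p_meas k).ennreal_ofReal, p k, ?_, fun t h0 _ => ⟨p_nonneg k h0, rfl⟩⟩
    simpa using p_lip k
  | succ n ih =>
    have := ih.step (by positivity)
    unfold H at *
    rw [Function.iterate_succ_apply']
    convert this using 1
    ring

theorem H_dual (k n : ℕ) : ∀ {g : ℝ → ℝ≥0∞}, Measurable g →
    ∫⁻ x, (A k).indicator (fun _ => 1) x * g (G^[n+1] x) ∂ν = ∫⁻ t, H k n t * g t ∂ν := by
  induction n with
  | zero =>
    intro g hg
    have := duality (F := (A k).indicator (fun _ => 1)) (measurable_const.indicator (A_meas k)) hg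
    simp only [zero_add, Function.iterate_one]
    rw [this]
    refine lintegral_congr_ae ?_
    filter_upwards [ν_ae_Ioo] with t ht
    congr 1
    unfold P H
    simp only [Function.iterate_zero, id]
    rw [tsum_eq_single k]
    · have : ((k:ℝ) + 1 + t)⁻¹ ∈ A k := by
        show ⌊(((k:ℝ) + 1 + t)⁻¹)⁻¹⌋ = (k:ℤ) + 1
        rw [inv_inv, Int.floor_eq_iff]
        push_cast
        constructor <;> linarith [ht.1, ht.2]
      simp [this]
    · intro j hj
      have : ((j:ℝ) + 1 + t)⁻¹ ∉ A k := by
        intro h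
        have h' : ⌊(((j:ℝ) + 1 + t)⁻¹)⁻¹⌋ = (k:ℤ) + 1 := h
        have h2 : ⌊(j:ℝ) + 1 + t⌋ = (j:ℤ) + 1 := by
          rw [Int.floor_eq_iff]
          push_cast
          constructor <;> linarith [ht.1, ht.2]
        rw [inv_inv, h2] at h'
        apply hj; omega
      simp [this]
  | succ n ih =>
    intro g hg
    have h1 := ih (hg.comp G_meas)
    have h2 := duality (H_good k n).1 hg
    unfold H at *
    rw [Function.iterate_succ_apply', ← h2]
    simp only [Function.comp] at h1
    rw [← h1]
    simp only [Function.iterate_succ_apply' G (n+1)]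

theorem decay (k n : ℕ) :
    ν.real (A k ∩ G^[n+1] ⁻¹' (A k)) ≤ ν.real (A k) ^ 2 + 2 * (11/12)^n := by
  have hA := A_meas k
  obtain ⟨hm, f, hf, hFf⟩ := H_good k n
  set L : ℝ := 2 * (11/12)^n with hLd
  have hL : 0 ≤ L := by positivity
  have e1 : ν (A k) = ∫⁻ t, H k n t ∂ν := by
    have := H_dual k n (g := fun _ => 1) measurable_const
    simp only [mul_one] at this
    rw [← this]
    exact (lintegral_indicator_one hA).symm
  have e2 : ν (A k ∩ G^[n+1] ⁻¹' (A k)) = ∫⁻ t in A k, H k n t ∂ν := by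
    have := H_dual k n (g := (A k).indicator (fun _ => 1)) (measurable_const.indicator hA)
    rw [← lintegral_indicator hA, ← lintegral_indicator_one (hA.inter ((G_meas.iterate _) hA))]
    convert this using 1
    · refine lintegral_congr (fun x => ?_)
      by_cases h : x ∈ A k <;> by_cases h' : G^[n+1] x ∈ A k <;> simp [h, h', Set.indicator, -Function.iterate_succ]
    · refine lintegral_congr (fun x => ?_)
      by_cases h : x ∈ A k <;> simp [h]
  -- pointwise bound
  have hpt : ∀ t, 0 < t → t < 1 → H k n t ≤ ENNReal.ofReal (ν.real (A k) + L) := by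
    intro t h0 h1
    rw [(hFf t h0.le h1.le).2]
    refine ENNReal.ofReal_le_ofReal ?_
    by_contra! hcon
    have hlow : ENNReal.ofReal (f t - L) ≤ ν (A k) := by
      rw [e1]
      have : ENNReal.ofReal (f t - L) = ∫⁻ _, ENNReal.ofReal (f t - L) ∂ν := by simp
      rw [this]
      refine lintegral_mono_ae ?_
      filter_upwards [ν_ae_Ioo] with s hs
      rw [(hFf s hs.1.le hs.2.le).2]
      refine ENNReal.ofReal_le_ofReal ?_
      have h3 := hf t s h0.le h1.le hs.1.le hs.2.le
      have h4 : |t - s| ≤ 1 := by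
        rw [abs_le]; constructor <;> linarith [hs.1, hs.2]
      have h5 : L * |t - s| ≤ L * 1 := mul_le_mul_of_nonneg_left h4 hL
      have h6 := le_abs_self (f t - f s)
      linarith
    have h7 : f t - L ≤ ν.real (A k) :=
      (ENNReal.ofReal_le_iff_le_toReal (measure_ne_top _ _)).1 hlow
    linarith
  have hub : ν (A k ∩ G^[n+1] ⁻¹' (A k)) ≤ ENNReal.ofReal (ν.real (A k) + L) * ν (A k) := by
    rw [e2, ← setLIntegral_const]
    refine lintegral_mono_ae (ae_restrict_of_ae ?_)
    filter_upwards [ν_ae_Ioo] with t ht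
    exact hpt t ht.1 ht.2
  have h0 : 0 ≤ ν.real (A k) := measureReal_nonneg
  have h1 : ν.real (A k) ≤ 1 := measureReal_le_one
  have hub' : ν.real (A k ∩ G^[n+1] ⁻¹' (A k)) ≤ (ν.real (A k) + L) * ν.real (A k) := by
    have := ENNReal.toReal_mono (by finiteness) hub
    rwa [ENNReal.toReal_mul, ENNReal.toReal_ofReal (by positivity)] at this
  nlinarith

theorem ν_A (k : ℕ) : ν.real (A k) =
    1 / Real.log 2 * Real.log (1 + 1 / (((k+1:ℕ):ℝ) * (((k+1:ℕ):ℝ) + 2))) := by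
  have hl : 0 < Real.log 2 := Real.log_pos one_lt_two
  have hk : (0:ℝ) ≤ k := k.cast_nonneg
  have h1 : ν (A k) = ν (Set.Ioc (((k:ℝ)+2)⁻¹) (((k:ℝ)+1)⁻¹)) := by
    refine measure_congr ?_
    filter_upwards [ν_ae_Ioo] with x hx
    apply propext
    show ⌊x⁻¹⌋ = (k:ℤ) + 1 ↔ (((k:ℝ)+2)⁻¹ < x ∧ x ≤ ((k:ℝ)+1)⁻¹)
    rw [Int.floor_eq_iff, inv_lt_comm₀ (by positivity) hx.1, le_inv_comm₀ hx.1 (by positivity)]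
    push_cast
    rw [show (k:ℝ) + 1 + 1 = k + 2 by ring]
    exact and_comm
  rw [measureReal_def, h1, ν_Ioc (by positivity) (by gcongr; linarith)
    (inv_le_one_of_one_le₀ (by linarith)), ENNReal.toReal_ofReal]
  · congr 2
    push_cast
    field_simp
    ring
  · have : 0 ≤ Real.log ((1 + ((k:ℝ)+1)⁻¹) / (1 + ((k:ℝ)+2)⁻¹)) := by
      apply Real.log_nonneg
      rw [le_div_iff₀ (by positivity), one_mul]
      gcongr; linarith
    positivity

theorem main_ae (k : ℕ) : ∀ᵐ x ∂(volume.restrict (Set.Ioo (0 : ℝ) 1)),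
    Tendsto (fun n : ℕ => (∑ i ∈ Finset.range n, (A k).indicator (fun _ => (1:ℝ)) (G^[i] x)) / n)
      atTop (nhds (1 / Real.log 2 * Real.log (1 + 1 / (((k+1:ℕ):ℝ) * (((k+1:ℕ):ℝ) + 2))))) := by
  have h := slln G_mp (A_meas k) (C := 2) (θ := 11/12) (by norm_num) (by norm_num) (by norm_num)
    (decay k)
  rw [ν_A] at h
  unfold ν at h
  rw [ae_withDensity_iff w_meas] at h
  filter_upwards [h, ae_restrict_mem measurableSet_Ioo] with x hx hx1
  apply hx
  have hl : 0 < Real.log 2 := Real.log_pos one_lt_two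
  have : 0 < 1 + x := by linarith [hx1.1]
  unfold w
  rw [Ne, ENNReal.ofReal_eq_zero, not_le]
  positivity

end
end GK

theorem gauss_kuzmin_statistics :
    ∀ᵐ x ∂(volume.restrict (Set.Ioo (0 : ℝ) 1)),
      ∀ k : ℕ, 0 < k →
        Tendsto
          (fun n : ℕ =>
            (((Finset.Icc 1 n).filter
                (fun i => ⌊((fun y : ℝ => Int.fract y⁻¹)^[i - 1] x)⁻¹⌋ = (k : ℤ))).card : ℝ) / n)
          atTop
          (nhds ((1 / Real.log 2) * Real.log (1 + 1 / ((k : ℝ) * ((k : ℝ) + 2))))) := by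
  rw [ae_all_iff]
  intro k
  rcases k with _ | k
  · simp
  filter_upwards [GK.main_ae k] with x hx _
  refine hx.congr (fun n => ?_)
  congr 1
  induction n with
  | zero => simp
  | succ n ih =>
    rw [Finset.sum_range_succ, ih, ← Finset.insert_Icc_right_eq_Icc_add_one (by omega),
      Finset.filter_insert]
    have hG : (fun y : ℝ => Int.fract y⁻¹) = GK.G := rfl
    rw [hG]
    by_cases h : GK.G^[n] x ∈ GK.A k
    · have h' : ⌊(GK.G^[n + 1 - 1] x)⁻¹⌋ = ((k + 1 : ℕ) : ℤ) := by
        push_cast; exact h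
      rw [if_pos h', Finset.card_insert_of_notMem (by simp), Set.indicator_of_mem h]
      push_cast; ring
    · have h' : ¬ ⌊(GK.G^[n + 1 - 1] x)⁻¹⌋ = ((k + 1 : ℕ) : ℤ) := by
        push_cast; exact h
      rw [if_neg h', Set.indicator_of_notMem h, add_zero]
end
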